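/- (Scaling law under loose verification, exact limiting form.) Let ρ ∈ (0,1] and α ∈ (0,1), and set α̃ := 1 − ρ(1 − α) and ε := 1 − α. Then the ratio of the limiting expected accepted lengths of loose and strict verification satisfies lim_{K→∞} (∑_{k=1}^{K} α̃^k) / (∑_{k=1}^{K} α^k) = (α̃/(1 − α̃)) / (α/(1 − α)) = (1 − ρε)/(ρα), and this ratio obeys the two-sided bound 1/ρ ≤ (1 − ρε)/(ρα) ≤ 1/(ρα). -/

import Mathlib

/-- The partial sums `∑_{k=1}^{K} p^k` converge to `p / (1 - p)`. -/
theorem tendsto_sum_range_pow_succ {p : ℝ} (h₀ : 0 ≤ p) (h₁ : p < 1) :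
    Filter.Tendsto (fun K : ℕ => ∑ k ∈ Finset.range K, p ^ (k + 1)) Filter.atTop
      (nhds (p / (1 - p))) := by
  simpa only [pow_succ', div_eq_mul_inv] using
    ((hasSum_geometric_of_lt_one h₀ h₁).mul_left p).tendsto_sum_nat

/-- **Scaling law under loose verification, exact limiting form.** For visual
density `ρ ∈ (0,1]` and alignment accuracy `α ∈ (0,1)`, with `α̃ := 1 - ρ(1 - α)` and
`ε := 1 - α`, the ratio of the limiting expected accepted lengths of loose and strict
verification satisfies
`lim_{K→∞} (∑_{k=1}^{K} α̃^k) / (∑_{k=1}^{K} α^k) = (α̃/(1-α̃)) / (α/(1-α)) = (1 - ρε)/(ρα)`,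
and moreover `1/ρ ≤ (1 - ρε)/(ρα) ≤ 1/(ρα)`. -/
theorem loose_over_strict_scaling_law (ρ α : ℝ) (hρ : ρ ∈ Set.Ioc (0 : ℝ) 1)
    (hα : α ∈ Set.Ioo (0 : ℝ) 1) (α' ε : ℝ) (hα' : α' = 1 - ρ * (1 - α)) (hε : ε = 1 - α) :
    Filter.Tendsto
        (fun K : ℕ => (∑ k ∈ Finset.range K, α' ^ (k + 1)) /
          (∑ k ∈ Finset.range K, α ^ (k + 1)))
        Filter.atTop (nhds ((α' / (1 - α')) / (α / (1 - α)))) ∧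
      (α' / (1 - α')) / (α / (1 - α)) = (1 - ρ * ε) / (ρ * α) ∧
      1 / ρ ≤ (1 - ρ * ε) / (ρ * α) ∧ (1 - ρ * ε) / (ρ * α) ≤ 1 / (ρ * α) := by
  obtain ⟨hρ₀, hρ₁⟩ := hρ
  obtain ⟨hα₀, hα₁⟩ := hα
  have hε₀ : 0 < 1 - α := sub_pos.2 hα₁
  have hρε : 0 < ρ * (1 - α) := mul_pos hρ₀ hε₀
  have hρα : 0 < ρ * α := mul_pos hρ₀ hα₀
  have hle : α ≤ 1 - ρ * (1 - α) := by nlinarith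
  subst hα' hε
  refine ⟨(tendsto_sum_range_pow_succ (hα₀.le.trans hle) (by linarith)).div
    (tendsto_sum_range_pow_succ hα₀.le hα₁) (div_pos hα₀ hε₀).ne', ?_, ?_, ?_⟩
  · rw [sub_sub_cancel]
    field_simp
  · rw [div_le_div_iff₀ hρ₀ hρα]
    nlinarith
  · gcongr
    linarith
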